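/- Let 𝒵 be a finite state space, let n ≥ 1, and for ℓ = 1, …, n let Z^ℓ be a jump path on 𝒵 with counting functions N^ℓ_{jk}, let R^ℓ ∈ (0,∞), and let w_ℓ ∈ ℝ be arbitrary weights. Define for t ≥ 0 and states j ≠ k: 𝕀_j(t) = Σ_{ℓ=1}^n w_ℓ · 1{t < R^ℓ} · 1{Z^ℓ(t) = j}, ℕ_{jk}(t) = Σ_{ℓ=1}^n w_ℓ · N^ℓ_{jk}(min(t, R^ℓ)), and ℂ_j(t) = Σ_{ℓ=1}^n w_ℓ · 1{R^ℓ ≤ t} · 1{Z^ℓ(R^ℓ) = j}. Then for every t ≥ 0 and every j ∈ 𝒵: 𝕀_j(t) = 𝕀_j(0) − ℂ_j(t) + Σ_{k ∈ 𝒵, k ≠ j} ( ℕ_{kj}(t) − ℕ_{jk}(t) ). -/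

import Mathlib

/-- A jump path on a finite state space `𝒵`: a function `ℝ → 𝒵` (of interest on `[0,∞)`)
which is right-continuous for the discrete topology (i.e. locally constant to the right),
admits left limits at every `t > 0` (i.e. is locally constant to the left, with value
`leftLim t`), and has only finitely many discontinuities in `(0,t]` for every `t > 0`. -/
structure JumpPath (𝒵 : Type*) [Fintype 𝒵] where
  toFun : ℝ → 𝒵
  leftLim : ℝ → 𝒵
  rightCont : ∀ t : ℝ, 0 ≤ t → ∃ δ > 0, ∀ s : ℝ, t ≤ s → s < t + δ → toFun s = toFun t
  leftLim_spec : ∀ t : ℝ, 0 < t → ∃ δ > 0, ∀ s : ℝ, t - δ < s → s < t → toFun s = leftLim t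
  finiteJumps : ∀ t : ℝ, 0 < t → {s : ℝ | 0 < s ∧ s ≤ t ∧ leftLim s ≠ toFun s}.Finite

/-- The counting function `N_{jk}(t) = #{s ∈ (0,t] : Z(s−) = j, Z(s) = k}` of a jump path. -/
noncomputable def JumpPath.countN {𝒵 : Type*} [Fintype 𝒵] (P : JumpPath 𝒵)
    (j k : 𝒵) (t : ℝ) : ℕ :=
  {s : ℝ | 0 < s ∧ s ≤ t ∧ P.leftLim s = j ∧ P.toFun s = k}.ncard

lemma JumpPath.leftLim_eq {𝒵 : Type*} [Fintype 𝒵] (P : JumpPath 𝒵) {a b : ℝ} (ha : 0 ≤ a)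
    (hab : a < b) {c : 𝒵} (h : ∀ s, a ≤ s → s < b → P.toFun s = c) : P.leftLim b = c := by
  obtain ⟨δ, hδ, hs⟩ := P.leftLim_spec b (by linarith)
  have h1 : max a (b - δ) < b := max_lt hab (by linarith)
  obtain ⟨s, hs1, hs2⟩ := exists_between h1
  have h2 := le_max_left a (b - δ)
  have h3 := le_max_right a (b - δ)
  rw [← hs s (by linarith) hs2, h s (by linarith) hs2]

lemma JumpPath.count_step {𝒵 : Type*} [Fintype 𝒵] [DecidableEq 𝒵] (P : JumpPath 𝒵) {a b : ℝ}
    (ha : 0 ≤ a) (hab : a < b) {c : 𝒵} (h : ∀ s, a ≤ s → s < b → P.toFun s = c)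
    (j k : 𝒵) (hjk : j ≠ k) :
    (P.countN j k b : ℝ) = P.countN j k a + if c = j ∧ P.toFun b = k then 1 else 0 := by
  have hl := P.leftLim_eq ha hab h
  have hmid : ∀ s, a < s → s < b → P.leftLim s = P.toFun s := fun s h1 h2 => by
    rw [h s h1.le h2]
    exact P.leftLim_eq ha h1 (fun u hu hu' => h u hu (hu'.trans h2))
  have hfin : {s : ℝ | 0 < s ∧ s ≤ a ∧ P.leftLim s = j ∧ P.toFun s = k}.Finite := by
    refine (P.finiteJumps b (by linarith)).subset ?_
    rintro s ⟨h1, h2, h3, h4⟩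
    exact ⟨h1, by linarith, by rw [h3, h4]; exact hjk⟩
  unfold JumpPath.countN
  split_ifs with hc
  · have : {s : ℝ | 0 < s ∧ s ≤ b ∧ P.leftLim s = j ∧ P.toFun s = k} =
        insert b {s : ℝ | 0 < s ∧ s ≤ a ∧ P.leftLim s = j ∧ P.toFun s = k} := by
      ext s
      simp only [Set.mem_setOf_eq, Set.mem_insert_iff]
      constructor
      · rintro ⟨h1, h2, h3, h4⟩
        rcases h2.eq_or_lt with h5 | h5
        · exact Or.inl h5
        · right
          refine ⟨h1, ?_, h3, h4⟩
          by_contra h6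
          exact hjk (by rw [← h3, ← h4]; exact hmid s (not_le.1 h6) h5)
      · rintro (rfl | ⟨h1, h2, h3⟩)
        · exact ⟨by linarith, le_rfl, hl.trans hc.1, hc.2⟩
        · exact ⟨h1, by linarith, h3⟩
    rw [this, Set.ncard_insert_of_notMem _ hfin]
    · push_cast; ring
    · rintro ⟨_, h2, _⟩
      linarith
  · have : {s : ℝ | 0 < s ∧ s ≤ b ∧ P.leftLim s = j ∧ P.toFun s = k} =
        {s : ℝ | 0 < s ∧ s ≤ a ∧ P.leftLim s = j ∧ P.toFun s = k} := by
      ext s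
      simp only [Set.mem_setOf_eq]
      constructor
      · rintro ⟨h1, h2, h3, h4⟩
        rcases h2.eq_or_lt with h5 | h5
        · subst h5
          exact absurd ⟨hl.symm.trans h3, h4⟩ hc
        · refine ⟨h1, ?_, h3, h4⟩
          by_contra h6
          exact hjk (by rw [← h3, ← h4]; exact hmid s (not_le.1 h6) h5)
      · rintro ⟨h1, h2, h3⟩
        exact ⟨h1, by linarith, h3⟩
    rw [this, add_zero]

/-- The conserved quantity. -/
noncomputable def JumpPath.auxF {𝒵 : Type*} [Fintype 𝒵] [DecidableEq 𝒵] (P : JumpPath 𝒵)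
    (j : 𝒵) (t : ℝ) : ℝ :=
  (if P.toFun t = j then (1:ℝ) else 0)
    - ∑ k ∈ Finset.univ.filter (fun k => k ≠ j), ((P.countN k j t : ℝ) - P.countN j k t)

lemma JumpPath.aux_sum {𝒵 : Type*} [Fintype 𝒵] [DecidableEq 𝒵] (j c d : 𝒵) :
    ∑ k ∈ Finset.univ.filter (fun k => k ≠ j), ((if c = k ∧ d = j then (1:ℝ) else 0)
      - if c = j ∧ d = k then (1:ℝ) else 0)
      = (if d = j then (1:ℝ) else 0) - if c = j then (1:ℝ) else 0 := by
  rw [Finset.sum_sub_distrib]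
  by_cases hd : d = j <;> by_cases hc : c = j <;>
    simp [hd, hc, Finset.filter_ne']

lemma JumpPath.auxF_step {𝒵 : Type*} [Fintype 𝒵] [DecidableEq 𝒵] (P : JumpPath 𝒵) {a b : ℝ}
    (ha : 0 ≤ a) (hab : a < b) {c : 𝒵} (h : ∀ s, a ≤ s → s < b → P.toFun s = c)
    (j : 𝒵) : P.auxF j b = P.auxF j a := by
  unfold JumpPath.auxF
  have h1 : ∑ k ∈ Finset.univ.filter (fun k => k ≠ j), ((P.countN k j b : ℝ) - P.countN j k b)
      = ∑ k ∈ Finset.univ.filter (fun k => k ≠ j), ((P.countN k j a : ℝ) - P.countN j k a)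
      + ∑ k ∈ Finset.univ.filter (fun k => k ≠ j), ((if c = k ∧ P.toFun b = j then (1:ℝ) else 0)
      - if c = j ∧ P.toFun b = k then (1:ℝ) else 0) := by
    rw [← Finset.sum_add_distrib]
    refine Finset.sum_congr rfl fun k hk => ?_
    have hk' : k ≠ j := (Finset.mem_filter.1 hk).2
    rw [P.count_step ha hab h k j hk', P.count_step ha hab h j k hk'.symm]
    ring
  rw [h1, JumpPath.aux_sum, h a le_rfl hab]
  ring

lemma JumpPath.auxF_const {𝒵 : Type*} [Fintype 𝒵] [DecidableEq 𝒵] (P : JumpPath 𝒵) {T : ℝ}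
    (hT : 0 ≤ T) (j : 𝒵) : P.auxF j T = P.auxF j 0 := by
  have hr : ∀ t, 0 ≤ t → ∃ δ > 0, ∀ s, t ≤ s → s < t + δ → P.auxF j s = P.auxF j t := by
    intro t ht
    obtain ⟨δ, hδ, h⟩ := P.rightCont t ht
    refine ⟨δ, hδ, fun s h1 h2 => ?_⟩
    rcases h1.eq_or_lt with h3 | h3
    · rw [h3]
    · exact P.auxF_step ht h3 (fun u hu hu' => h u hu (by linarith)) j
  have hl : ∀ t, 0 ≤ t → ∃ δ > 0, ∀ s, 0 ≤ s → t - δ < s → s < t → P.auxF j s = P.auxF j t := by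
    intro t ht
    rcases ht.eq_or_lt with h0 | h0
    · exact ⟨1, one_pos, fun s h1 _ h2 => by linarith⟩
    obtain ⟨δ, hδ, h⟩ := P.leftLim_spec t h0
    exact ⟨δ, hδ, fun s h1 h2 h3 =>
      (P.auxF_step h1 h3 (fun u hu hu' => h u (by linarith) hu') j).symm⟩
  refine constant_of_has_deriv_right_zero (a := 0) (b := T) ?_ ?_ T ⟨hT, le_rfl⟩
  · intro t ht
    obtain ⟨δ, hδ, h1⟩ := hr t ht.1
    obtain ⟨ε, hε, h2⟩ := hl t ht.1
    have : ∀ᶠ s in nhdsWithin t (Set.Icc 0 T), P.auxF j s = P.auxF j t := by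
      filter_upwards [self_mem_nhdsWithin, mem_nhdsWithin_of_mem_nhds
        (Ioo_mem_nhds (show t - ε < t by linarith) (show t < t + δ by linarith))] with s hs hs'
      rcases lt_or_ge s t with h | h
      · exact h2 s hs.1 hs'.1 h
      · exact h1 s h hs'.2
    exact (continuousWithinAt_const (b := P.auxF j t)).congr_of_eventuallyEq this rfl
  · intro t ht
    obtain ⟨δ, hδ, h1⟩ := hr t ht.1
    have : ∀ᶠ s in nhdsWithin t (Set.Ici t), P.auxF j s = P.auxF j t := by
      filter_upwards [self_mem_nhdsWithin, mem_nhdsWithin_of_mem_nhds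
        (Iio_mem_nhds (show t < t + δ by linarith))] with s hs hs'
      exact h1 s hs hs'
    exact (hasDerivWithinAt_const t _ (P.auxF j t)).congr_of_eventuallyEq this rfl

lemma JumpPath.count_identity {𝒵 : Type*} [Fintype 𝒵] [DecidableEq 𝒵] (P : JumpPath 𝒵) {T : ℝ}
    (hT : 0 ≤ T) (j : 𝒵) :
    ∑ k ∈ Finset.univ.filter (fun k => k ≠ j), ((P.countN k j T : ℝ) - P.countN j k T)
      = (if P.toFun T = j then (1:ℝ) else 0) - if P.toFun 0 = j then (1:ℝ) else 0 := by
  have h := P.auxF_const hT j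
  have h0 : ∀ i k, P.countN i k 0 = 0 := by
    intro i k
    unfold JumpPath.countN
    have : {s : ℝ | 0 < s ∧ s ≤ 0 ∧ P.leftLim s = i ∧ P.toFun s = k} = ∅ := by
      ext s
      simp only [Set.mem_setOf_eq, Set.mem_empty_iff_false, iff_false]
      rintro ⟨h1, h2, _⟩
      linarith
    rw [this, Set.ncard_empty]
  unfold JumpPath.auxF at h
  simp only [h0, Nat.cast_zero, sub_self, Finset.sum_const_zero, sub_zero] at h
  linarith

open Finset in
/-- Weighted-sample decomposition underlying the Nadaraya–Watson kernel estimators: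
`𝕀_j(t) = 𝕀_j(0) − ℂ_j(t) + Σ_{k≠j} (ℕ_{kj}(t) − ℕ_{jk}(t))`, where
`𝕀_j(t) = Σ_ℓ w_ℓ 1{t<R^ℓ} 1{Z^ℓ(t)=j}`, `ℕ_{jk}(t) = Σ_ℓ w_ℓ N^ℓ_{jk}(t ∧ R^ℓ)` and
`ℂ_j(t) = Σ_ℓ w_ℓ 1{R^ℓ≤t} 1{Z^ℓ(R^ℓ)=j}`. -/
theorem weighted_sojourn_transition_identity {𝒵 : Type*} [Fintype 𝒵] [DecidableEq 𝒵]
    (n : ℕ) (hn : 1 ≤ n) (Z : Fin n → JumpPath 𝒵) (R : Fin n → ℝ)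
    (hR : ∀ ℓ, 0 < R ℓ) (w : Fin n → ℝ)
    (I : 𝒵 → ℝ → ℝ)
    (hI : ∀ j t, I j t = ∑ ℓ, w ℓ * (if t < R ℓ then (1:ℝ) else 0)
        * (if (Z ℓ).toFun t = j then (1:ℝ) else 0))
    (Nw : 𝒵 → 𝒵 → ℝ → ℝ)
    (hNw : ∀ j k t, Nw j k t = ∑ ℓ, w ℓ * ((Z ℓ).countN j k (min t (R ℓ)) : ℝ))
    (C : 𝒵 → ℝ → ℝ)
    (hC : ∀ j t, C j t = ∑ ℓ, w ℓ * (if R ℓ ≤ t then (1:ℝ) else 0)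
        * (if (Z ℓ).toFun (R ℓ) = j then (1:ℝ) else 0))
    (t : ℝ) (ht : 0 ≤ t) (j : 𝒵) :
    I j t = I j 0 - C j t
        + ∑ k ∈ Finset.univ.filter (fun k => k ≠ j), (Nw k j t - Nw j k t) := by

  have key : ∑ k ∈ Finset.univ.filter (fun k => k ≠ j), (Nw k j t - Nw j k t)
      = ∑ ℓ, w ℓ * ((if (Z ℓ).toFun (min t (R ℓ)) = j then (1:ℝ) else 0)
        - if (Z ℓ).toFun 0 = j then (1:ℝ) else 0) := by
    simp only [hNw, ← Finset.sum_sub_distrib, ← mul_sub]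
    rw [Finset.sum_comm]
    refine Finset.sum_congr rfl fun ℓ _ => ?_
    rw [← Finset.mul_sum, (Z ℓ).count_identity (le_min ht (hR ℓ).le)]
  rw [key, hI, hI, hC, ← Finset.sum_sub_distrib, ← Finset.sum_add_distrib]
  refine Finset.sum_congr rfl fun ℓ _ => ?_
  rw [if_pos (hR ℓ)]
  rcases lt_or_ge t (R ℓ) with h | h
  · rw [if_pos h, if_neg (not_le.2 h), min_eq_left h.le]
    ring
  · rw [if_neg (not_lt.2 h), if_pos h, min_eq_right h]
    ring
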